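/- Let A be a commutative ring and M any cochain complex of A-modules. Then there exist a K-flat cochain complex P of A-modules and a quasi-isomorphism P → M which is surjective in every degree. -/

import Mathlib

/-!
STATEMENT 9: Let `A` be a commutative ring and `M` any cochain complex of `A`-modules.
Then there exist a K-flat cochain complex `P` of `A`-modules and a quasi-isomorphism
`P → M` which is surjective in every degree.

Here the tensor product of complexes is `HomologicalComplex.tensorObj`
(`(G ⊗ F)^n = ⊕_{i+j=n} G^i ⊗_A F^j` with the Koszul sign differential), and `F` is
K-flat if `G ⊗_A F` is acyclic for every acyclic `G`.
-/

open CategoryTheory Limits MonoidalCategory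

variable {A : Type} [CommRing A]

instance : (curriedTensor (ModuleCat A)).Additive where
  map_add := by intros; ext; simp [curriedTensor]

instance (X : ModuleCat A) : ((curriedTensor (ModuleCat A)).obj X).Additive :=
  inferInstanceAs (tensorLeft X).Additive

/-- A cochain complex is acyclic if it is exact in every degree. -/
def IsAcyclic (C : CochainComplex (ModuleCat A) ℤ) : Prop := ∀ i : ℤ, C.ExactAt i

/-- A cochain complex `F` of `A`-modules is K-flat if `G ⊗_A F` is acyclic
for every acyclic cochain complex `G`. -/
def IsKFlat (F : CochainComplex (ModuleCat A) ℤ) : Prop :=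
  ∀ G : CochainComplex (ModuleCat A) ℤ, IsAcyclic G →
    IsAcyclic (HomologicalComplex.tensorObj G F)


namespace KFlatRes

/-- Trees indexing the basis of the semi-free resolution. -/
inductive Gen (M : CochainComplex (ModuleCat.{0} A) ℤ) : ℤ → Type
  | mk (n : ℤ) (m : M.X n) (k : ℕ) (a : Fin k → A) (c : Fin k → Gen M (n + 1)) : Gen M n

variable (M : CochainComplex (ModuleCat.{0} A) ℤ)

open Classical in
/-- Differential and augmentation on generators. -/
noncomputable def dat : {n : ℤ} → Gen M n → (Gen M (n + 1) →₀ A) × M.X n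
  | _, .mk n m _ a c =>
    if (∑ l, a l • (dat (c l)).1) = 0 ∧ (∑ l, a l • (dat (c l)).2) = (M.d n (n + 1)).hom m then
      (∑ l, Finsupp.single (c l) (a l), m)
    else (0, 0)

/-- The differential. -/
noncomputable def D (n : ℤ) : (Gen M n →₀ A) →ₗ[A] (Gen M (n + 1) →₀ A) :=
  Finsupp.linearCombination A (fun e => (dat M e).1)

/-- The augmentation. -/
noncomputable def aug (n : ℤ) : (Gen M n →₀ A) →ₗ[A] M.X n :=
  Finsupp.linearCombination A (fun e => (dat M e).2)

lemma D_single (n : ℤ) (e : Gen M n) (r : A) :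
    D M n (Finsupp.single e r) = r • (dat M e).1 := by
  simp [D]

lemma aug_single (n : ℤ) (e : Gen M n) (r : A) :
    aug M n (Finsupp.single e r) = r • (dat M e).2 := by
  simp [aug]

lemma dat_mk_of (n : ℤ) (m : M.X n) (k : ℕ) (a : Fin k → A) (c : Fin k → Gen M (n + 1))
    (h₁ : D M (n + 1) (∑ l, Finsupp.single (c l) (a l)) = 0)
    (h₂ : aug M (n + 1) (∑ l, Finsupp.single (c l) (a l)) = (M.d n (n + 1)).hom m) :
    dat M (.mk n m k a c) = (∑ l, Finsupp.single (c l) (a l), m) := by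
  simp only [map_sum, D_single, aug_single] at h₁ h₂
  rw [dat, if_pos ⟨h₁, h₂⟩]

lemma D_dat (n : ℤ) (e : Gen M n) : D M (n + 1) (dat M e).1 = 0 := by
  obtain ⟨_, m, k, a, c⟩ := e
  rw [dat]
  split_ifs with h
  · simpa only [map_sum, D_single] using h.1
  · simp

lemma aug_dat (n : ℤ) (e : Gen M n) :
    aug M (n + 1) (dat M e).1 = (M.d n (n + 1)).hom (dat M e).2 := by
  obtain ⟨_, m, k, a, c⟩ := e
  rw [dat]
  split_ifs with h
  · simpa only [map_sum, aug_single] using h.2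
  · simp

lemma D_D (n : ℤ) (p : Gen M n →₀ A) : D M (n + 1) (D M n p) = 0 := by
  induction p using Finsupp.induction_linear with
  | zero => simp
  | add f g hf hg => simp [hf, hg]
  | single e r => simp [D_single, D_dat]

lemma aug_D (n : ℤ) (p : Gen M n →₀ A) :
    aug M (n + 1) (D M n p) = (M.d n (n + 1)).hom (aug M n p) := by
  induction p using Finsupp.induction_linear with
  | zero => simp
  | add f g hf hg => simp [hf, hg]
  | single e r => simp [D_single, aug_single, aug_dat]

/-- Every finitely supported function is a sum of singles over `Fin k`. -/
lemma exists_sum {X : Type} (p : X →₀ A) :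
    ∃ (k : ℕ) (a : Fin k → A) (c : Fin k → X), ∑ l, Finsupp.single (c l) (a l) = p := by
  refine ⟨p.support.card, fun l => p (p.support.equivFin.symm l),
    fun l => p.support.equivFin.symm l, ?_⟩
  rw [Equiv.sum_comp p.support.equivFin.symm
    (fun x : p.support => Finsupp.single (x : X) (p x))]
  rw [Finset.sum_coe_sort p.support (fun x => Finsupp.single x (p x))]
  exact p.sum_single

lemma key (n : ℤ) (p : Gen M (n + 1) →₀ A) (m : M.X n) (h₁ : D M (n + 1) p = 0)
    (h₂ : aug M (n + 1) p = (M.d n (n + 1)).hom m) :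
    ∃ q : Gen M n →₀ A, D M n q = p ∧ aug M n q = m := by
  obtain ⟨k, a, c, rfl⟩ := exists_sum p
  refine ⟨Finsupp.single (.mk n m k a c) 1, ?_, ?_⟩
  · rw [D_single, dat_mk_of M n m k a c h₁ h₂, one_smul]
  · rw [aug_single, dat_mk_of M n m k a c h₁ h₂, one_smul]

/-- The resolution. -/
noncomputable def P : CochainComplex (ModuleCat.{0} A) ℤ :=
  CochainComplex.of (fun n => ModuleCat.of A (Gen M n →₀ A)) (fun n => ModuleCat.ofHom (D M n))
    (fun n => by ext1; exact LinearMap.ext (D_D M n))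

lemma P_d (n : ℤ) : (P M).d n (n + 1) = ModuleCat.ofHom (D M n) :=
  CochainComplex.of_d (fun n => ModuleCat.of A (Gen M n →₀ A)) (fun n => ModuleCat.ofHom (D M n)) n

/-- The augmentation map. -/
noncomputable def π : P M ⟶ M :=
  CochainComplex.ofHom (fun n => ModuleCat.ofHom (aug M n)) (fun n => by
    rw [P_d]; ext1; exact LinearMap.ext fun p => (aug_D M n p).symm)

lemma π_surj (n : ℤ) : Function.Surjective ((π M).f n) := by
  intro m
  obtain ⟨p, hp, hp'⟩ := key M (n + 1) 0 ((M.d n (n + 1)).hom m) (by simp) (by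
    simp [← ModuleCat.comp_apply])
  obtain ⟨q, hq, hq'⟩ := key M n p m hp hp'
  exact ⟨q, hq'⟩

lemma homologyπ_eq_iff (K : CochainComplex (ModuleCat.{0} A) ℤ) (n : ℤ)
    (z : K.cycles (n + 1)) :
    K.homologyπ (n + 1) z = 0 ↔ ∃ y, K.d n (n + 1) y = K.iCycles (n + 1) z := by
  have w : K.toCycles n (n + 1) ≫ K.homologyπ (n + 1) = 0 := by simp
  have ex : (ShortComplex.mk _ _ w).Exact :=
    ShortComplex.exact_of_g_is_cokernel _ (K.homologyIsCokernel n (n + 1) (by simp))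
  rw [ShortComplex.moduleCat_exact_iff] at ex
  constructor
  · intro h
    obtain ⟨y, hy⟩ := ex z h
    refine ⟨y, ?_⟩
    rw [← hy]
    dsimp
    rw [← ModuleCat.comp_apply, HomologicalComplex.toCycles_i]
  · rintro ⟨y, hy⟩
    have : z = K.toCycles n (n + 1) y := by
      apply (ModuleCat.mono_iff_injective (K.iCycles (n + 1))).1 inferInstance
      rw [← hy, ← ModuleCat.comp_apply, HomologicalComplex.toCycles_i]
    rw [this, ← ModuleCat.comp_apply, w]
    rfl

lemma exists_cycle (K : CochainComplex (ModuleCat.{0} A) ℤ) (n : ℤ)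
    (x : K.X n) (hx : K.d n (n + 1) x = 0) : ∃ z : K.cycles n, K.iCycles n z = x := by
  have h : ModuleCat.ofHom (LinearMap.toSpanSingleton A (K.X n) x) ≫ K.d n (n + 1) = 0 := by
    ext1
    apply LinearMap.ext_ring
    simpa using hx
  refine ⟨(K.liftCycles _ (n + 1) (by simp) h) (1 : A), ?_⟩
  rw [← ModuleCat.comp_apply, HomologicalComplex.liftCycles_i]
  simp

lemma π_quasiIso : QuasiIso (π M) := by
  rw [quasiIso_iff]
  intro i
  obtain ⟨n, rfl⟩ : ∃ n, i = n + 1 := ⟨i - 1, by simp⟩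
  rw [quasiIsoAt_iff_isIso_homologyMap, ConcreteCategory.isIso_iff_bijective]
  constructor
  · rw [injective_iff_map_eq_zero]
    intro x hx
    obtain ⟨z, rfl⟩ := (ModuleCat.epi_iff_surjective ((P M).homologyπ (n + 1))).1 inferInstance x
    rw [← ModuleCat.comp_apply, HomologicalComplex.homologyπ_naturality, ModuleCat.comp_apply,
      homologyπ_eq_iff] at hx
    obtain ⟨m, hm⟩ := hx
    rw [← ModuleCat.comp_apply, HomologicalComplex.cyclesMap_i, ModuleCat.comp_apply] at hm
    rw [homologyπ_eq_iff, P_d]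
    obtain ⟨q, hq, -⟩ := key M n ((P M).iCycles (n + 1) z) m (by
      have := congr($((P M).iCycles_d (n + 1) (n + 1 + 1)) z)
      rw [P_d] at this
      exact this) hm.symm
    exact ⟨q, hq⟩
  · intro y
    obtain ⟨z, rfl⟩ := (ModuleCat.epi_iff_surjective (M.homologyπ (n + 1))).1 inferInstance y
    obtain ⟨q, hq, hq'⟩ := key M (n + 1) 0 (M.iCycles (n + 1) z) (by simp) (by
      simp [← ModuleCat.comp_apply])
    obtain ⟨w, hw⟩ := exists_cycle (P M) (n + 1) q (by rw [P_d]; exact hq)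
    refine ⟨(P M).homologyπ (n + 1) w, ?_⟩
    rw [← ModuleCat.comp_apply, HomologicalComplex.homologyπ_naturality, ModuleCat.comp_apply]
    congr 1
    apply (ModuleCat.mono_iff_injective (M.iCycles (n + 1))).1 inferInstance
    rw [← ModuleCat.comp_apply, HomologicalComplex.cyclesMap_i, ModuleCat.comp_apply, hw]
    exact hq'

lemma linearMap_sum_comp {X Y Z : Type} [AddCommGroup X] [AddCommGroup Y] [AddCommGroup Z]
    [Module A X] [Module A Y] [Module A Z] {k : ℕ} (f : Fin k → (Y →ₗ[A] Z)) (u : X →ₗ[A] Y) :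
    (∑ l, f l) ∘ₗ u = ∑ l, f l ∘ₗ u := by
  ext; simp

section flat

variable (G : CochainComplex (ModuleCat.{0} A) ℤ) (J : ModuleCat.{0} A) (N : ℤ)
  (B : ∀ i j : ℤ, i + j = N → (Gen M j →₀ A) →ₗ[A] (G.X i →ₗ[A] J))

open Classical in
/-- The contraction, on generators. -/
noncomputable def con : {j : ℤ} → Gen M j → (i : ℤ) → i + j = N + 1 → (G.X i →ₗ[A] J)
  | _, .mk j m k a c => fun i h =>
    if H : ∃ φ : G.X i →ₗ[A] J, ∀ (i' : ℤ) (h' : i' + 1 = i), φ ∘ₗ (G.d i' i).hom =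
      B i' j (by omega) (Finsupp.single (.mk j m k a c) 1) - (i'.negOnePow : ℤ) •
        (if (∑ l, a l • (dat M (c l)).1) = 0 ∧
            (∑ l, a l • (dat M (c l)).2) = (M.d j (j + 1)).hom m then
          ∑ l, a l • con (c l) i' (by omega) else 0)
    then H.choose else 0

/-- The contraction. -/
noncomputable def con' (i j : ℤ) (h : i + j = N + 1) : (Gen M j →₀ A) →ₗ[A] (G.X i →ₗ[A] J) :=
  Finsupp.linearCombination A (fun e => con M G J N B e i h)

lemma con'_single (i j : ℤ) (h : i + j = N + 1) (e : Gen M j) (r : A) :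
    con' M G J N B i j h (Finsupp.single e r) = r • con M G J N B e i h := by
  simp [con']

lemma con'_dat (i j : ℤ) (h : i + (j + 1) = N + 1) (m : M.X j) (k : ℕ) (a : Fin k → A)
    (c : Fin k → Gen M (j + 1)) :
    con' M G J N B i (j + 1) h (dat M (.mk j m k a c)).1 =
      open Classical in (if (∑ l, a l • (dat M (c l)).1) = 0 ∧
            (∑ l, a l • (dat M (c l)).2) = (M.d j (j + 1)).hom m then
          ∑ l, a l • con M G J N B (c l) i h else 0) := by
  rw [dat]
  split_ifs with h
  · simp only [map_sum, con'_single]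
  · simp

lemma extend [Injective J] (hG : IsAcyclic G) (i₀ i₁ i₂ : ℤ) (h₁ : i₀ + 1 = i₁) (h₂ : i₁ + 1 = i₂)
    (ψ : G.X i₁ →ₗ[A] J) (hψ : ψ ∘ₗ (G.d i₀ i₁).hom = 0) :
    ∃ φ : G.X i₂ →ₗ[A] J, φ ∘ₗ (G.d i₁ i₂).hom = ψ := by
  have ex := hG i₁
  rw [HomologicalComplex.exactAt_iff' _ i₀ i₁ i₂ (by simp; omega) (by simp; omega)] at ex
  have w : G.d i₀ i₁ ≫ ModuleCat.ofHom ψ = 0 := by ext1; exact hψ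
  refine ⟨(ex.descToInjective (ModuleCat.ofHom ψ) w).hom, ?_⟩
  exact congr(ModuleCat.Hom.hom $(ex.comp_descToInjective (ModuleCat.ofHom ψ) w))

lemma con_spec (hB : ∀ (i j : ℤ) (h : i + 1 + j = N) (p : Gen M j →₀ A),
    B (i + 1) j h p ∘ₗ (G.d i (i + 1)).hom +
    (i.negOnePow : ℤ) • B i (j + 1) (by omega) (D M j p) = 0)
    [Injective J] (hG : IsAcyclic G) {j : ℤ} (e : Gen M j) :
    ∀ (i : ℤ) (h : i + 1 + j = N + 1),
    con M G J N B e (i + 1) h ∘ₗ (G.d i (i + 1)).hom =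
      B i j (by omega) (Finsupp.single e 1) -
      (i.negOnePow : ℤ) • con' M G J N B i (j + 1) (by omega) (dat M e).1 := by
  induction e with
  | mk j m k a c ih =>
    intro i h
    have H : ∃ φ : G.X (i + 1) →ₗ[A] J, ∀ (i' : ℤ) (h' : i' + 1 = i + 1),
        φ ∘ₗ (G.d i' (i + 1)).hom =
        B i' j (by omega) (Finsupp.single (.mk j m k a c) 1) - (i'.negOnePow : ℤ) •
          con' M G J N B i' (j + 1) (by omega) (dat M (.mk j m k a c)).1 := by
      obtain ⟨i₀, rfl⟩ : ∃ i₀, i = i₀ + 1 := ⟨i - 1, by simp⟩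
      obtain ⟨φ, hφ⟩ := extend G J hG i₀ (i₀ + 1) (i₀ + 1 + 1) rfl rfl
        (B (i₀ + 1) j (by omega) (Finsupp.single (.mk j m k a c) 1) - ((i₀ + 1).negOnePow : ℤ) •
          con' M G J N B (i₀ + 1) (j + 1) (by omega) (dat M (.mk j m k a c)).1) (by
        have h1 := hB i₀ j (by omega) (Finsupp.single (.mk j m k a c) 1)
        have h2 : con' M G J N B (i₀ + 1) (j + 1) (by omega) (dat M (.mk j m k a c)).1 ∘ₗ
            (G.d i₀ (i₀ + 1)).hom =
            B i₀ (j + 1) (by omega) (dat M (.mk j m k a c)).1 - (i₀.negOnePow : ℤ) •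
            con' M G J N B i₀ (j + 1 + 1) (by omega) (D M (j + 1) (dat M (.mk j m k a c)).1) := by
          rw [dat]
          split_ifs
          · simp only [map_sum, con'_single, linearMap_sum_comp, LinearMap.smul_comp,
              D_single, map_smul, Finset.smul_sum, ← Finset.sum_sub_distrib]
            refine Finset.sum_congr rfl fun l _ => ?_
            rw [ih l i₀ (by omega), smul_sub, smul_comm (a l), ← map_smul (B _ _ _)]
            simp
          · simp
        rw [D_dat, map_zero, smul_zero, sub_zero] at h2
        rw [D_single, one_smul] at h1
        rw [LinearMap.sub_comp, LinearMap.smul_comp, h2, Int.negOnePow_succ]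
        rw [← h1]
        simp)
      refine ⟨φ, fun i' h' => ?_⟩
      obtain rfl : i' = i₀ + 1 := by omega
      exact hφ
    simp only [con'_dat] at H ⊢
    rw [con]
    beta_reduce
    rw [dif_pos H]
    exact H.choose_spec i rfl

lemma con'_spec (hB : ∀ (i j : ℤ) (h : i + 1 + j = N) (p : Gen M j →₀ A),
    B (i + 1) j h p ∘ₗ (G.d i (i + 1)).hom +
    (i.negOnePow : ℤ) • B i (j + 1) (by omega) (D M j p) = 0)
    [Injective J] (hG : IsAcyclic G) (i j : ℤ) (h : i + 1 + j = N + 1)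
    (p : Gen M j →₀ A) :
    con' M G J N B (i + 1) j h p ∘ₗ (G.d i (i + 1)).hom +
      (i.negOnePow : ℤ) • con' M G J N B i (j + 1) (by omega) (D M j p) =
      B i j (by omega) p := by
  induction p using Finsupp.induction_linear with
  | zero => simp
  | add f g hf hg =>
    simp only [map_add, ← hf, ← hg, LinearMap.add_comp, smul_add]
    abel
  | single e r =>
    rw [con'_single, D_single, LinearMap.smul_comp, con_spec M G J N B hB hG, map_smul,
      smul_comm _ r, ← smul_add, sub_add_cancel, ← map_smul]
    simp

end flat

open HomologicalComplex in
lemma ι_d (G K : CochainComplex (ModuleCat.{0} A) ℤ) (i j n : ℤ) (h : i + j = n) :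
    ιTensorObj G K i j n h ≫ (HomologicalComplex.tensorObj G K).d n (n + 1) =
      (G.d i (i + 1) ▷ K.X j) ≫ ιTensorObj G K (i + 1) j (n + 1) (by omega) +
      (i.negOnePow : ℤ) •
        ((G.X i ◁ K.d j (j + 1)) ≫ ιTensorObj G K i (j + 1) (n + 1) (by omega)) := by
  rw [mapBifunctor.d_eq, Preadditive.comp_add, mapBifunctor.ι_D₁, mapBifunctor.ι_D₂,
    mapBifunctor.d₁_eq G K (curriedTensor (ModuleCat A)) (ComplexShape.up ℤ)
      (i₁ := i) (i₁' := i + 1) rfl j (n + 1) (by change i + 1 + j = n + 1; omega),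
    mapBifunctor.d₂_eq G K (curriedTensor (ModuleCat A)) (ComplexShape.up ℤ)
      i (i₂ := j) (i₂' := j + 1) rfl (n + 1) (by change i + (j + 1) = n + 1; omega)]
  congr 1
  exact one_smul _ _

open HomologicalComplex in
lemma P_kFlat : IsKFlat (P M) := by
  intro G hG i
  obtain ⟨n, rfl⟩ : ∃ n, i = n + 1 := ⟨i - 1, by simp⟩
  rw [HomologicalComplex.exactAt_iff' _ n (n + 1) (n + 1 + 1) (by simp) (by simp),
    ShortComplex.moduleCat_exact_iff]
  let T := HomologicalComplex.tensorObj G (P M)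
  intro (z : T.X (n + 1)) hz
  change T.d (n + 1) (n + 1 + 1) z = 0 at hz
  let Q := cokernel (T.d n (n + 1))
  let J := Injective.under Q
  let χ : T.X (n + 1) ⟶ J := cokernel.π (T.d n (n + 1)) ≫ Injective.ι Q
  have hχ : T.d n (n + 1) ≫ χ = 0 := by simp [χ]
  let B : ∀ i j : ℤ, i + j = n + 1 → (Gen M j →₀ A) →ₗ[A] (G.X i →ₗ[A] J) := fun i j h =>
    (TensorProduct.curry (ιTensorObj G (P M) i j (n + 1) h ≫ χ).hom).flip
  have hB : ∀ (i j : ℤ) (h : i + 1 + j = n + 1) (p : Gen M j →₀ A),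
      B (i + 1) j h p ∘ₗ (G.d i (i + 1)).hom +
      (i.negOnePow : ℤ) • B i (j + 1) (by omega) (D M j p) = 0 := by
    intro i j h p
    ext g
    have := ι_d G (P M) i j n (by omega) =≫ χ
    rw [Category.assoc, hχ, comp_zero, P_d] at this
    have := congr(ModuleCat.Hom.hom $this (g ⊗ₜ[A] p))
    simp only [Preadditive.add_comp, Preadditive.zsmul_comp, Category.assoc] at this
    exact this.symm
  let S : ∀ i j : ℤ, i + j = n + 1 + 1 → (G.X i ⊗ (P M).X j ⟶ J) := fun i j h =>
    ModuleCat.ofHom (TensorProduct.lift (con' M G J (n + 1) B i j h).flip)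
  obtain ⟨χ', hι⟩ : ∃ χ' : T.X (n + 1 + 1) ⟶ J, ∀ (i j : ℤ) (h : i + j = n + 1 + 1),
      ιTensorObj G (P M) i j (n + 1 + 1) h ≫ χ' = S i j h :=
    ⟨mapBifunctorDesc S, fun i j h => ι_mapBifunctorDesc (K₁ := G) (K₂ := P M)
      (F := curriedTensor (ModuleCat A)) (c := ComplexShape.up ℤ) S i j h⟩
  have hχ' : T.d (n + 1) (n + 1 + 1) ≫ χ' = χ := by
    apply mapBifunctor.hom_ext
    intro i j h
    have h0 : i + j = n + 1 := h
    have h1 := ι_d G (P M) i j (n + 1) h =≫ χ'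
    rw [Category.assoc] at h1
    refine h1.trans ?_
    simp only [Preadditive.add_comp, Preadditive.zsmul_comp, Category.assoc, hι, P_d]
    ext1
    apply TensorProduct.ext'
    intro g p
    exact congr($(con'_spec M G J (n + 1) B hB hG i j (by omega) p) g)
  have hz' : χ z = 0 := by
    rw [← hχ', ModuleCat.comp_apply, hz, map_zero]
  have hz'' : cokernel.π (T.d n (n + 1)) z = 0 := by
    apply (ModuleCat.mono_iff_injective (Injective.ι Q)).1 inferInstance
    rw [map_zero, ← hz']
    rfl
  have ex : (ShortComplex.mk _ _ (cokernel.condition (T.d n (n + 1)))).Exact :=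
    ShortComplex.exact_of_g_is_cokernel _ (cokernelIsCokernel _)
  rw [ShortComplex.moduleCat_exact_iff] at ex
  exact ex z hz''

end KFlatRes

theorem exists_kFlat_resolution (M : CochainComplex (ModuleCat A) ℤ) :
    ∃ (P : CochainComplex (ModuleCat A) ℤ) (π : P ⟶ M),
      IsKFlat P ∧ QuasiIso π ∧ ∀ n : ℤ, Function.Surjective (π.f n) :=
  ⟨KFlatRes.P M, KFlatRes.π M, KFlatRes.P_kFlat M, KFlatRes.π_quasiIso M, KFlatRes.π_surj M⟩
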